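/- Suppose that ∫_Y D_π dπ ≥ δ for some δ > 0, that |∫_Y f dμ − ∫_Y f dπ| ≤ ε₁ for every f : Y → ℝ that is 1-Lipschitz with respect to d, and that sup_{x∈Y} |D_π(x) − D_μ(x)| ≤ ε₂. If for some ρ ∈ (0,1] one has (1/δ)( 3ε₁/ρ + ε₂ + 2 π(Ā_ρ) ) < 1, then ∫_Y D_μ dμ > 0. -/

import Mathlib

open MeasureTheory

/-- The largest `1`-Lipschitz function below `f` (Pasch–Hausdorff envelope). -/
noncomputable def lipschitzEnvelope {Y : Type*} [MetricSpace Y] (f : Y → ℝ) (x : Y) : ℝ :=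
  ⨅ y, (f y + dist x y)

section lipschitzEnvelope

variable {Y : Type*} [MetricSpace Y] {f : Y → ℝ}

theorem bddBelow_range_add_dist (hf : ∀ x, 0 ≤ f x) (x : Y) :
    BddBelow (Set.range fun y => f y + dist x y) :=
  ⟨0, by rintro _ ⟨y, rfl⟩; exact add_nonneg (hf y) dist_nonneg⟩

theorem lipschitzEnvelope_le (hf : ∀ x, 0 ≤ f x) (x : Y) : lipschitzEnvelope f x ≤ f x := by
  simpa [lipschitzEnvelope] using ciInf_le (bddBelow_range_add_dist hf x) x

theorem lipschitzEnvelope_nonneg (hf : ∀ x, 0 ≤ f x) (x : Y) : 0 ≤ lipschitzEnvelope f x :=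
  Real.iInf_nonneg fun y => add_nonneg (hf y) dist_nonneg

theorem lipschitzWith_lipschitzEnvelope (hf : ∀ x, 0 ≤ f x) :
    LipschitzWith 1 (lipschitzEnvelope f) := by
  refine LipschitzWith.of_le_add fun x z => ?_
  have : Nonempty Y := ⟨x⟩
  rw [← sub_le_iff_le_add]
  refine le_ciInf fun y => ?_
  have h : lipschitzEnvelope f x ≤ f y + dist x y := ciInf_le (bddBelow_range_add_dist hf x) y
  linarith [dist_triangle x z y]

end lipschitzEnvelope

/-- `ρ * D` lies below its Lipschitz envelope at distance more than `ρ` from the set where the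
one-sided `1 / ρ`-Lipschitz bound on `D` fails. -/
theorem le_lipschitzEnvelope_of_notMem {Y : Type*} [MetricSpace Y] {D : Y → ℝ} {ρ : ℝ}
    (hρ : 0 < ρ) (hD : ∀ x, D x ∈ Set.Icc (0 : ℝ) 1) {x : Y}
    (hx : x ∉ {x : Y | Metric.infEDist x
      {z : Y | ∃ y : Y, D z + dist z y / ρ < D y} ≤ ENNReal.ofReal ρ}) :
    ρ * D x ≤ lipschitzEnvelope (fun y => ρ * D y) x := by
  have : Nonempty Y := ⟨x⟩
  refine le_ciInf fun y => ?_
  by_contra! h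
  have hmem : y ∈ {z : Y | ∃ y : Y, D z + dist z y / ρ < D y} := by
    refine ⟨x, ?_⟩
    have h' : (D y + dist y x / ρ) * ρ < D x * ρ := by
      rw [add_mul, div_mul_cancel₀ _ hρ.ne', dist_comm]
      linarith
    exact lt_of_mul_lt_mul_right h' hρ.le
  refine hx ((Metric.infEDist_le_edist_of_mem hmem).trans ?_)
  rw [edist_dist]
  refine ENNReal.ofReal_le_ofReal ?_
  nlinarith [mul_nonneg hρ.le (hD y).1, mul_le_mul_of_nonneg_left (hD x).2 hρ.le]

/-- If the right-hand side `(1/δ)(3ε₁/ρ + ε₂ + 2 π(Ā_ρ))` of the conditional-measure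
stability bound is strictly smaller than `1` for some `ρ ∈ (0,1]`, then
`∫ D_μ dμ > 0`. -/
theorem stmt17 {Y : Type*} [MetricSpace Y] [PolishSpace Y]
    [MeasurableSpace Y] [BorelSpace Y]
    (hdiam : ∀ x y : Y, dist x y ≤ 1)
    (μ π : Measure Y) [IsProbabilityMeasure μ] [IsProbabilityMeasure π]
    (Dμ Dπ : Y → ℝ) (hDμmeas : Measurable Dμ) (hDπmeas : Measurable Dπ)
    (hDμ01 : ∀ x, Dμ x ∈ Set.Icc (0 : ℝ) 1) (hDπ01 : ∀ x, Dπ x ∈ Set.Icc (0 : ℝ) 1)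
    (δ ε₁ ε₂ : ℝ) (hδ : 0 < δ)
    (hδle : δ ≤ ∫ x, Dπ x ∂π)
    (hε₁ : ∀ f : Y → ℝ, LipschitzWith 1 f →
      |(∫ x, f x ∂μ) - (∫ x, f x ∂π)| ≤ ε₁)
    (hε₂ : ∀ x, |Dπ x - Dμ x| ≤ ε₂)
    (ρ : ℝ) (hρ0 : 0 < ρ) (hρ1 : ρ ≤ 1)
    (hsmall : (1 / δ) * (3 * ε₁ / ρ + ε₂
        + 2 * (π {x : Y | EMetric.infEdist x
            {z : Y | ∃ y : Y, Dπ z + dist z y / ρ < Dπ y} ≤ ENNReal.ofReal ρ}).toReal) < 1) :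
    0 < ∫ x, Dμ x ∂μ := by
  set A : Set Y := {x : Y | EMetric.infEdist x
    {z : Y | ∃ y : Y, Dπ z + dist z y / ρ < Dπ y} ≤ ENNReal.ofReal ρ}
  have hAmeas : MeasurableSet A :=
    (isClosed_le Metric.continuous_infEDist continuous_const).measurableSet
  have hf : ∀ x, 0 ≤ ρ * Dπ x := fun x => mul_nonneg hρ0.le (hDπ01 x).1
  set g : Y → ℝ := lipschitzEnvelope fun y => ρ * Dπ y
  have hgLip : LipschitzWith 1 g := lipschitzWith_lipschitzEnvelope hf
  have hg0 : ∀ x, 0 ≤ g x := lipschitzEnvelope_nonneg hf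
  have hgle : ∀ x, g x ≤ ρ * Dπ x := lipschitzEnvelope_le hf
  have integrable_of_bounds : ∀ (ν : Measure Y) [IsProbabilityMeasure ν] (h : Y → ℝ),
      Measurable h → (∀ x, 0 ≤ h x) → (∀ x, h x ≤ 1) → Integrable h ν :=
    fun ν _ h hm h0 h1 => Integrable.of_bound hm.aestronglyMeasurable 1
      (.of_forall fun x => by rw [Real.norm_of_nonneg (h0 x)]; exact h1 x)
  have hg1 : ∀ x, g x ≤ 1 := fun x =>
    (hgle x).trans (mul_le_one₀ hρ1 (hDπ01 x).1 (hDπ01 x).2)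
  have hgμ := integrable_of_bounds μ g hgLip.continuous.measurable hg0 hg1
  have hgπ := integrable_of_bounds π g hgLip.continuous.measurable hg0 hg1
  have hDμ := integrable_of_bounds μ Dμ hDμmeas (fun x => (hDμ01 x).1) fun x => (hDμ01 x).2
  have hDπ := integrable_of_bounds π Dπ hDπmeas (fun x => (hDπ01 x).1) fun x => (hDπ01 x).2
  have hμ : ∫ x, g x ∂μ ≤ ρ * (∫ x, Dμ x ∂μ) + ρ * ε₂ := by
    calc ∫ x, g x ∂μ ≤ ∫ x, (ρ * Dμ x + ρ * ε₂) ∂μ := by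
          refine integral_mono hgμ ((hDμ.const_mul ρ).add (integrable_const _)) fun x => ?_
          have := mul_le_mul_of_nonneg_left ((le_abs_self _).trans (hε₂ x)) hρ0.le
          linarith [hgle x]
      _ = _ := by
          rw [integral_add (hDμ.const_mul ρ) (integrable_const _), integral_const_mul]
          simp
  have hind : Integrable (A.indicator fun _ => ρ) π := (integrable_const ρ).indicator hAmeas
  have hπ : ρ * (∫ x, Dπ x ∂π) ≤ (∫ x, g x ∂π) + ρ * (π A).toReal := by
    calc ρ * (∫ x, Dπ x ∂π) = ∫ x, ρ * Dπ x ∂π := (integral_const_mul _ _).symm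
      _ ≤ ∫ x, (g x + A.indicator (fun _ => ρ) x) ∂π := by
          refine integral_mono (hDπ.const_mul ρ) (hgπ.add hind) fun x => ?_
          by_cases hx : x ∈ A
          · simp only [Set.indicator_of_mem hx]
            nlinarith [hg0 x, (hDπ01 x).2]
          · simpa only [Set.indicator_of_notMem hx, add_zero] using
              le_lipschitzEnvelope_of_notMem hρ0 hDπ01 hx
      _ = _ := by
          rw [integral_add hgπ hind, integral_indicator_const _ hAmeas, smul_eq_mul, mul_comm ρ]
          rfl
  have hdiff := neg_le_of_abs_le (hε₁ g hgLip)
  have hε₁0 : 0 ≤ ε₁ := (abs_nonneg _).trans (hε₁ g hgLip)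
  have hA0 : 0 ≤ (π A).toReal := ENNReal.toReal_nonneg
  have hlt : ρ * (3 * ε₁ / ρ + ε₂ + 2 * (π A).toReal) < ρ * δ := by
    rw [one_div, inv_mul_lt_iff₀ hδ, mul_one] at hsmall
    exact mul_lt_mul_of_pos_left hsmall hρ0
  have hcancel : ρ * (3 * ε₁ / ρ) = 3 * ε₁ := mul_div_cancel₀ _ hρ0.ne'
  refine pos_of_mul_pos_right (a := ρ) ?_ hρ0.le
  linarith [mul_le_mul_of_nonneg_left hδle hρ0.le, mul_nonneg hρ0.le hA0]
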